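/- Let $w \in A_r$ with $1 \le r < \infty$ and $v \in RH_{s'}(w)$ with $1 \le s < \infty$. For every $1 \le q \le s$, $0 < \alpha \le 1$ and $t > 0$, and every measurable $h$ on $\mathbb{R}^{n+1}_+$, one has $\int_{\mathbb{R}^n}\big(\int_{B(x,\alpha t)} |h(y,t)|\, \frac{dw(y)}{w(B(y,\alpha t))}\big)^{1/q} v(x)\,dw(x) \le C\, \alpha^{nr(1/s - 1/q)} \int_{\mathbb{R}^n}\big(\int_{B(x,t)} |h(y,t)|\, \frac{dw(y)}{w(B(y,t))}\big)^{1/q} v(x)\,dw(x)$, with $C$ independent of $\alpha$ and $t$. -/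

import Mathlib

open MeasureTheory Metric ENNReal NNReal Set

noncomputable section

/-- `w ∈ A_r` with constant at most `C` (for `1 ≤ r < ∞`), with respect to Lebesgue measure. -/
def apBound (n : ℕ) (w : EuclideanSpace ℝ (Fin n) → ℝ≥0∞) (r : ℝ) (C : ℝ≥0∞) : Prop :=
  ∀ (c : EuclideanSpace ℝ (Fin n)) (ρ : ℝ), 0 < ρ →
    (if r = 1 then
      ((∫⁻ x in ball c ρ, w x) / volume (ball c ρ)) *
        essSup (fun x => (w x)⁻¹) (volume.restrict (ball c ρ))
    else
      ((∫⁻ x in ball c ρ, w x) / volume (ball c ρ)) *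
        (((∫⁻ x in ball c ρ, (w x) ^ (-(1/(r-1)))) / volume (ball c ρ)) ^ (r - 1))) ≤ C

/-- `v ∈ RH_{s'}(w)` with constant at most `C`, where `1 ≤ s < ∞` and `s' = s/(s-1)`
(with `s' = ∞`, i.e. `RH_∞(w)`, when `s = 1`); averages with respect to `dw = w dx`. -/
def rhConjBoundW (n : ℕ) (w v : EuclideanSpace ℝ (Fin n) → ℝ≥0∞) (s : ℝ) (C : ℝ≥0∞) : Prop :=
  ∀ (c : EuclideanSpace ℝ (Fin n)) (ρ : ℝ), 0 < ρ →
    (if s = 1 then essSup v ((volume.withDensity w).restrict (ball c ρ))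
      else ((∫⁻ x in ball c ρ, (v x) ^ (s/(s-1)) * w x) /
              (∫⁻ x in ball c ρ, w x)) ^ ((s-1)/s))
      ≤ C * ((∫⁻ x in ball c ρ, v x * w x) / (∫⁻ x in ball c ρ, w x))

section metric

variable {X : Type*} [PseudoMetricSpace X] [MeasurableSpace X]

/-- The average over the slice `ball x ρ` of the cone with vertex `x`. -/
def sliceAverage (μ : Measure X) (g : X → ℝ≥0∞) (ρ : ℝ) (x : X) : ℝ≥0∞ :=
  ∫⁻ y in ball x ρ, g y / μ (ball y ρ) ∂μ

theorem measurableSet_dist_lt [SecondCountableTopology X] [BorelSpace X]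
    (ρ : ℝ) : MeasurableSet {p : X × X | dist p.1 p.2 < ρ} :=
  (isOpen_lt (by fun_prop) continuous_const).measurableSet

theorem measurable_measure_ball [SecondCountableTopology X] [BorelSpace X]
    (μ : Measure X) [SFinite μ] (ρ : ℝ) :
    Measurable fun y => μ (ball y ρ) := by
  have := measurable_measure_prodMk_left (ν := μ) (measurableSet_dist_lt (X := X) ρ)
  convert this using 3 with y
  ext z; simp [dist_comm]

theorem measurable_setLIntegral_ball [SecondCountableTopology X] [BorelSpace X]
    (μ : Measure X) [SFinite μ] {f : X → ℝ≥0∞}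
    (hf : Measurable f) (ρ : ℝ) : Measurable fun x => ∫⁻ y in ball x ρ, f y ∂μ := by
  have : Measurable fun x => ∫⁻ y, {p : X × X | dist p.1 p.2 < ρ}.indicator
      (fun p => f p.2) (x, y) ∂μ :=
    ((hf.comp measurable_snd).indicator (measurableSet_dist_lt ρ)).lintegral_prod_right'
  convert this using 2 with x
  rw [← lintegral_indicator measurableSet_ball]
  congr 1
  ext y
  simp [indicator, dist_comm]

theorem measurable_sliceAverage [SecondCountableTopology X] [BorelSpace X]
    (μ : Measure X) [SFinite μ] {g : X → ℝ≥0∞}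
    (hg : Measurable g) (ρ : ℝ) : Measurable (sliceAverage μ g ρ) :=
  measurable_setLIntegral_ball μ (hg.div (measurable_measure_ball μ ρ)) ρ

/-- Tonelli's theorem over the region `dist x y < ρ`. -/
theorem lintegral_setLIntegral_ball_swap [SecondCountableTopology X] [BorelSpace X]
    (μ ν : Measure X) [SFinite μ] [SFinite ν]
    {f : X → ℝ≥0∞} (hf : Measurable f) (ρ : ℝ) :
    ∫⁻ x, ∫⁻ y in ball x ρ, f y ∂μ ∂ν = ∫⁻ y, f y * ν (ball y ρ) ∂μ := by
  have hF : Measurable ({p : X × X | dist p.1 p.2 < ρ}.indicator (fun p => f p.2)) :=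
    (hf.comp measurable_snd).indicator (measurableSet_dist_lt ρ)
  calc ∫⁻ x, ∫⁻ y in ball x ρ, f y ∂μ ∂ν
      = ∫⁻ x, ∫⁻ y, {p : X × X | dist p.1 p.2 < ρ}.indicator (fun p => f p.2) (x, y) ∂μ ∂ν := by
        refine lintegral_congr fun x => ?_
        rw [← lintegral_indicator measurableSet_ball]
        refine lintegral_congr fun y => ?_
        simp [indicator, dist_comm]
    _ = ∫⁻ y, ∫⁻ x, {p : X × X | dist p.1 p.2 < ρ}.indicator (fun p => f p.2) (x, y) ∂ν ∂μ :=
        lintegral_lintegral_swap hF.aemeasurable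
    _ = ∫⁻ y, f y * ν (ball y ρ) ∂μ := by
        refine lintegral_congr fun y => ?_
        rw [← setLIntegral_const, ← lintegral_indicator measurableSet_ball]
        refine lintegral_congr fun x => ?_
        simp [indicator]

theorem setLIntegral_sliceAverage_le [SecondCountableTopology X] [BorelSpace X]
    (μ : Measure X) [SFinite μ] {g : X → ℝ≥0∞}
    (hg : Measurable g) (z : X) (R ρ : ℝ) :
    ∫⁻ x in ball z R, sliceAverage μ g ρ x ∂μ ≤ ∫⁻ y in ball z (R + ρ), g y ∂μ := by
  unfold sliceAverage
  rw [lintegral_setLIntegral_ball_swap μ (μ.restrict (ball z R))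
    (f := fun y => g y / μ (ball y ρ)) (hg.div (measurable_measure_ball μ ρ)),
    ← lintegral_indicator measurableSet_ball]
  refine lintegral_mono fun y => ?_
  by_cases hy : y ∈ ball z (R + ρ)
  · rw [indicator_of_mem hy]
    calc g y / μ (ball y ρ) * μ.restrict (ball z R) (ball y ρ)
        ≤ g y / μ (ball y ρ) * μ (ball y ρ) := by gcongr; exact Measure.restrict_le_self
      _ ≤ g y := by rw [mul_comm]; exact ENNReal.mul_div_le
  · have : ball y ρ ∩ ball z R = ∅ := by
      by_contra hne
      obtain ⟨x, hxy, hxz⟩ := nonempty_iff_ne_empty.mpr hne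
      rw [mem_ball] at *
      linarith [dist_triangle_left y z x]
    rw [Measure.restrict_apply measurableSet_ball, this]
    simp

/-- An inequality on all balls of a fixed radius integrates to a global inequality. -/
theorem lintegral_le_of_forall_setLIntegral_ball_le {E : Type*} [NormedAddCommGroup E]
    [NormedSpace ℝ E] [FiniteDimensional ℝ E] [MeasureSpace E] [BorelSpace E]
    [(volume : Measure E).IsAddHaarMeasure] (μ : Measure E) [SFinite μ] {F G : E → ℝ≥0∞}
    (hF : Measurable F) (hG : Measurable G) {K : ℝ≥0∞} {ρ : ℝ} (hρ : 0 < ρ)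
    (hFG : ∀ z, ∫⁻ x in ball z ρ, F x ∂μ ≤ K * ∫⁻ x in ball z ρ, G x ∂μ) :
    ∫⁻ x, F x ∂μ ≤ K * ∫⁻ x, G x ∂μ := by
  have : ProperSpace E := FiniteDimensional.proper ℝ E
  have key : ∀ {f : E → ℝ≥0∞}, Measurable f →
      ∫⁻ z : E, ∫⁻ x in ball z ρ, f x ∂μ = (∫⁻ x, f x ∂μ) * volume (ball (0 : E) ρ) := by
    intro f hf
    rw [lintegral_setLIntegral_ball_swap μ volume hf, ← lintegral_mul_const _ hf]
    refine lintegral_congr fun y => ?_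
    rw [Measure.addHaar_ball_center]
  have h := lintegral_mono (μ := (volume : Measure E)) hFG
  rw [lintegral_const_mul _ (measurable_setLIntegral_ball μ hG ρ), key hF, key hG,
    ← mul_assoc] at h
  exact (ENNReal.mul_le_mul_iff_left (measure_ball_pos _ _ hρ).ne' measure_ball_lt_top.ne).1 h

theorem setLIntegral_rpow_mul_le {Y : Type*} [MeasurableSpace Y] {μ : Measure Y} {B : Set Y}
    (hB0 : μ B ≠ 0) (hB : μ B ≠ ∞) {f v : Y → ℝ≥0∞} (hf : Measurable f) (hv : Measurable v)
    {s q : ℝ} (hq1 : 1 ≤ q) (hqs : q ≤ s) {Cv c A : ℝ≥0∞}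
    (hRH : (if s = 1 then essSup v (μ.restrict B)
      else ((∫⁻ x in B, v x ^ (s / (s - 1)) ∂μ) / μ B) ^ ((s - 1) / s))
      ≤ Cv * ((∫⁻ x in B, v x ∂μ) / μ B))
    (hM : ∀ᵐ x ∂μ.restrict B, f x ≤ c * A) (hA : ∫⁻ x in B, f x ∂μ ≤ A * μ B) :
    ∫⁻ x in B, f x ^ (1 / q) * v x ∂μ
      ≤ Cv * c ^ (1 / q - 1 / s) * A ^ (1 / q) * ∫⁻ x in B, v x ∂μ := by
  have hq : 0 < q := by linarith
  have hs : 0 < s := by linarith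
  split_ifs at hRH with h1
  · obtain rfl : q = 1 := by linarith
    subst h1
    simp only [div_one, ENNReal.rpow_one, sub_self, ENNReal.rpow_zero, mul_one]
    calc ∫⁻ x in B, f x * v x ∂μ
        ≤ ∫⁻ x in B, f x * essSup v (μ.restrict B) ∂μ := by
          refine lintegral_mono_ae ?_
          filter_upwards [ENNReal.ae_le_essSup v] with x hx
          gcongr
      _ = (∫⁻ x in B, f x ∂μ) * essSup v (μ.restrict B) := lintegral_mul_const _ hf
      _ ≤ (A * μ B) * (Cv * ((∫⁻ x in B, v x ∂μ) / μ B)) := by gcongr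
      _ = Cv * A * ((∫⁻ x in B, v x ∂μ) / μ B * μ B) := by ring
      _ = _ := by rw [ENNReal.div_mul_cancel hB0 hB]
  · have hs1 : 1 < s := lt_of_le_of_ne (by linarith) (Ne.symm h1)
    have hconj : s.HolderConjugate (s / (s - 1)) := Real.HolderConjugate.conjExponent hs1
    have hsq : 0 ≤ s / q - 1 := by rw [sub_nonneg, le_div_iff₀ hq]; linarith
    have hqs' : 0 ≤ 1 / q - 1 / s := sub_nonneg.2 (one_div_le_one_div_of_le hq hqs)
    have hfs : (∫⁻ x in B, (f x ^ (1 / q)) ^ s ∂μ) ^ (1 / s)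
        ≤ c ^ (1 / q - 1 / s) * A ^ (1 / q) * μ B ^ (1 / s) := by
      calc (∫⁻ x in B, (f x ^ (1 / q)) ^ s ∂μ) ^ (1 / s)
          ≤ (∫⁻ x in B, f x * (c * A) ^ (s / q - 1) ∂μ) ^ (1 / s) := by
            gcongr ?_ ^ _
            refine lintegral_mono_ae ?_
            filter_upwards [hM] with x hx
            rw [← ENNReal.rpow_mul, show 1 / q * s = 1 + (s / q - 1) by ring,
              ENNReal.rpow_add_of_nonneg _ _ zero_le_one hsq, ENNReal.rpow_one]
            gcongr
        _ ≤ (A * μ B * (c * A) ^ (s / q - 1)) ^ (1 / s) := by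
            rw [lintegral_mul_const _ hf]
            gcongr
        _ = _ := by
            rw [ENNReal.mul_rpow_of_nonneg _ _ (by positivity),
              ENNReal.mul_rpow_of_nonneg _ _ (by positivity), ← ENNReal.rpow_mul,
              show (s / q - 1) * (1 / s) = 1 / q - 1 / s by field_simp,
              ENNReal.mul_rpow_of_nonneg _ _ hqs']
            have hexp : A ^ (1 / q) = A ^ (1 / s) * A ^ (1 / q - 1 / s) := by
              rw [← ENNReal.rpow_add_of_nonneg _ _ (by positivity) hqs', add_sub_cancel]
            rw [hexp]
            ring
    have hvs : (∫⁻ x in B, v x ^ (s / (s - 1)) ∂μ) ^ (1 / (s / (s - 1)))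
        ≤ μ B ^ (1 - 1 / s) * (Cv * ((∫⁻ x in B, v x ∂μ) / μ B)) := by
      have he : 1 / (s / (s - 1)) = (s - 1) / s := one_div_div _ _
      have hpos : 0 ≤ (s - 1) / s := div_nonneg (by linarith) hs.le
      rw [he, show 1 - 1 / s = (s - 1) / s by field_simp]
      calc (∫⁻ x in B, v x ^ (s / (s - 1)) ∂μ) ^ ((s - 1) / s)
          = (μ B * ((∫⁻ x in B, v x ^ (s / (s - 1)) ∂μ) / μ B)) ^ ((s - 1) / s) := by
            rw [ENNReal.mul_div_cancel hB0 hB]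
        _ ≤ _ := by
            rw [ENNReal.mul_rpow_of_nonneg _ _ hpos]
            gcongr
    calc ∫⁻ x in B, f x ^ (1 / q) * v x ∂μ
        ≤ (∫⁻ x in B, (f x ^ (1 / q)) ^ s ∂μ) ^ (1 / s) *
            (∫⁻ x in B, v x ^ (s / (s - 1)) ∂μ) ^ (1 / (s / (s - 1))) :=
          ENNReal.lintegral_mul_le_Lp_mul_Lq _ hconj (hf.pow_const _).aemeasurable
            hv.aemeasurable
      _ ≤ (c ^ (1 / q - 1 / s) * A ^ (1 / q) * μ B ^ (1 / s)) *
            (μ B ^ (1 - 1 / s) * (Cv * ((∫⁻ x in B, v x ∂μ) / μ B))) := by gcongr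
      _ = Cv * c ^ (1 / q - 1 / s) * A ^ (1 / q) *
            (((∫⁻ x in B, v x ∂μ) / μ B) * (μ B ^ (1 / s) * μ B ^ (1 - 1 / s))) := by ring
      _ = _ := by
          rw [← ENNReal.rpow_add _ _ hB0 hB, show 1 / s + (1 - 1 / s) = 1 by ring,
            ENNReal.rpow_one, ENNReal.div_mul_cancel hB0 hB]

theorem ENNReal.inv_le_mul_inv_mul_inv {a b d k : ℝ≥0∞} (ha : a ≠ 0) (ha' : a ≠ ∞) (hb : b ≠ 0)
    (hb' : b ≠ ∞) (hd : d ≠ 0) (hd' : d ≠ ∞) (h : a * b ≤ k * d) : d⁻¹ ≤ k * a⁻¹ * b⁻¹ := by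
  calc d⁻¹ = (a * b) * (a⁻¹ * b⁻¹ * d⁻¹) := by
        rw [show a * b * (a⁻¹ * b⁻¹ * d⁻¹) = (a * a⁻¹) * (b * b⁻¹) * d⁻¹ by ring,
          ENNReal.mul_inv_cancel ha ha', ENNReal.mul_inv_cancel hb hb', one_mul, one_mul]
    _ ≤ (k * d) * (a⁻¹ * b⁻¹ * d⁻¹) := by gcongr
    _ = k * a⁻¹ * b⁻¹ * (d * d⁻¹) := by ring
    _ = _ := by rw [ENNReal.mul_inv_cancel hd hd', mul_one]

/-- `μ` gives finite positive mass to balls, which decays at most like the power `m` of the radius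
under concentric shrinking. -/
structure BallDecay (μ : Measure X) (m : ℝ) (K : ℝ≥0∞) : Prop where
  ne_zero : ∀ c ρ, 0 < ρ → μ (ball c ρ) ≠ 0
  ne_top : ∀ c ρ, 0 < ρ → μ (ball c ρ) ≠ ∞
  decay : ∀ c ρ R, 0 < ρ → ρ ≤ R →
    ENNReal.ofReal (ρ / R) ^ m * μ (ball c R) ≤ K * μ (ball c ρ)

/-- The mass of a ball is controlled from below by that of any ball lying in a dilate of it. -/
theorem BallDecay.inv_le {μ : Measure X} {m : ℝ} {K : ℝ≥0∞} (h : BallDecay μ m K) (hm : 0 ≤ m)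
    {c c' : X} {a ρ R' : ℝ} (ha : 0 < a) (ha1 : a ≤ 1) (hρ : 0 < ρ) (hR' : 0 < R')
    (hsub : ball c' R' ⊆ ball c (ρ / a)) :
    (μ (ball c ρ))⁻¹ ≤ K * (ENNReal.ofReal a ^ m)⁻¹ * (μ (ball c' R'))⁻¹ := by
  have hd := h.decay c ρ (ρ / a) hρ (by rw [le_div_iff₀ ha]; nlinarith)
  rw [div_div_cancel₀ hρ.ne'] at hd
  refine ENNReal.inv_le_mul_inv_mul_inv ?_ ?_ (h.ne_zero _ _ hR') (h.ne_top _ _ hR')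
    (h.ne_zero _ _ hρ) (h.ne_top _ _ hρ) ((by gcongr : _ ≤ _).trans hd)
  · exact (ENNReal.rpow_pos (by simpa) ENNReal.ofReal_ne_top).ne'
  · exact ENNReal.rpow_ne_top_of_nonneg hm ENNReal.ofReal_ne_top

variable {μ : Measure X} {m : ℝ} {K : ℝ≥0∞}

theorem BallDecay.sliceAverage_le [BorelSpace X] (h : BallDecay μ m K) (hm : 0 ≤ m) {g : X → ℝ≥0∞}
    (hg : Measurable g) {x z : X} {α t : ℝ} (hα : 0 < α) (hα2 : α ≤ 1 / 2) (ht : 0 < t)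
    (hx : x ∈ ball z (t / 4)) :
    sliceAverage μ g (α * t) x ≤ K * (ENNReal.ofReal α ^ m)⁻¹ *
      ((∫⁻ y in ball z (3 * t / 4), g y ∂μ) / μ (ball z (t / 4))) := by
  rw [mem_ball] at hx
  have hαt : α * t ≤ t / 2 := by nlinarith
  have hsub : ball x (α * t) ⊆ ball z (3 * t / 4) := ball_subset_ball' (by linarith)
  calc sliceAverage μ g (α * t) x
      ≤ ∫⁻ y in ball z (3 * t / 4), g y * (K * (ENNReal.ofReal α ^ m)⁻¹ *
          (μ (ball z (t / 4)))⁻¹) ∂μ := by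
        refine (lintegral_mono_set hsub).trans (setLIntegral_mono' measurableSet_ball ?_)
        intro y hy
        rw [mem_ball'] at hy
        rw [div_eq_mul_inv (G := ℝ≥0∞)]
        gcongr
        refine h.inv_le hm hα (by linarith) (by positivity) (by positivity) ?_
        rw [mul_div_cancel_left₀ _ hα.ne']
        exact ball_subset_ball' (by linarith)
    _ = _ := by rw [lintegral_mul_const _ hg, div_eq_mul_inv (G := ℝ≥0∞)]; ring

theorem BallDecay.le_sliceAverage [BorelSpace X] (h : BallDecay μ m K) (hm : 0 ≤ m) {g : X → ℝ≥0∞}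
    (hg : Measurable g) (hK : K ≠ ∞) {x z : X} {t : ℝ} (ht : 0 < t) (hx : x ∈ ball z (t / 4)) :
    (∫⁻ y in ball z (3 * t / 4), g y ∂μ) / μ (ball z (t / 4)) ≤
      K * (ENNReal.ofReal (1 / 8) ^ m)⁻¹ * sliceAverage μ g t x := by
  rw [mem_ball'] at hx
  have hsub : ball z (3 * t / 4) ⊆ ball x t := ball_subset_ball' (by linarith)
  have hc : K * (ENNReal.ofReal (1 / 8) ^ m)⁻¹ ≠ ∞ :=
    ENNReal.mul_ne_top hK (ENNReal.inv_ne_top.2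
      (ENNReal.rpow_pos (by simp) ENNReal.ofReal_ne_top).ne')
  calc (∫⁻ y in ball z (3 * t / 4), g y ∂μ) / μ (ball z (t / 4))
      = ∫⁻ y in ball z (3 * t / 4), g y * (μ (ball z (t / 4)))⁻¹ ∂μ := by
        rw [lintegral_mul_const _ hg, div_eq_mul_inv (G := ℝ≥0∞)]
    _ ≤ ∫⁻ y in ball z (3 * t / 4),
          K * (ENNReal.ofReal (1 / 8) ^ m)⁻¹ * (g y / μ (ball y t)) ∂μ := by
        refine setLIntegral_mono' measurableSet_ball fun y hy => ?_
        rw [mem_ball] at hy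
        rw [div_eq_mul_inv (G := ℝ≥0∞), mul_left_comm]
        gcongr
        refine h.inv_le hm (by norm_num) (by norm_num) (by positivity) ht ?_
        exact ball_subset_ball' (by linarith)
    _ ≤ _ := by
        rw [lintegral_const_mul' _ _ hc]
        gcongr
        exact lintegral_mono_set hsub

theorem BallDecay.sliceAverage_le_of_half_le (h : BallDecay μ m K) (hm : 0 ≤ m) (hK : K ≠ ∞)
    (g : X → ℝ≥0∞) (x : X) {α t : ℝ} (hα : 1 / 2 ≤ α) (hα1 : α ≤ 1) (ht : 0 < t) :
    sliceAverage μ g (α * t) x ≤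
      K * (ENNReal.ofReal (1 / 2) ^ m)⁻¹ * sliceAverage μ g t x := by
  have hαt : 0 < α * t := by nlinarith
  have hc : K * (ENNReal.ofReal (1 / 2) ^ m)⁻¹ ≠ ∞ :=
    ENNReal.mul_ne_top hK (ENNReal.inv_ne_top.2
      (ENNReal.rpow_pos (by simp) ENNReal.ofReal_ne_top).ne')
  unfold sliceAverage
  rw [← lintegral_const_mul' _ _ hc]
  refine (lintegral_mono_set (ball_subset_ball (by nlinarith))).trans (lintegral_mono fun y => ?_)
  rw [div_eq_mul_inv (G := ℝ≥0∞), div_eq_mul_inv (G := ℝ≥0∞), mul_left_comm]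
  gcongr
  refine h.inv_le hm (by norm_num) (by norm_num) hαt ht (ball_subset_ball ?_)
  rw [le_div_iff₀ (by norm_num)]
  nlinarith

theorem BallDecay.setLIntegral_sliceAverage_rpow_le [SecondCountableTopology X] [BorelSpace X]
    [SFinite μ] (h : BallDecay μ m K)
    (hm : 0 ≤ m) (hK : K ≠ ∞) {g v : X → ℝ≥0∞} (hg : Measurable g) (hv : Measurable v)
    {s q : ℝ} (hq1 : 1 ≤ q) (hqs : q ≤ s) {Cv : ℝ≥0∞} {α t : ℝ} (hα : 0 < α) (hα2 : α ≤ 1 / 2)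
    (ht : 0 < t) (z : X)
    (hRH : (if s = 1 then essSup v (μ.restrict (ball z (t / 4)))
      else ((∫⁻ x in ball z (t / 4), v x ^ (s / (s - 1)) ∂μ) / μ (ball z (t / 4))) ^ ((s - 1) / s))
      ≤ Cv * ((∫⁻ x in ball z (t / 4), v x ∂μ) / μ (ball z (t / 4)))) :
    ∫⁻ x in ball z (t / 4), sliceAverage μ g (α * t) x ^ (1 / q) * v x ∂μ ≤
      Cv * K ^ (1 / q - 1 / s) * (K * (ENNReal.ofReal (1 / 8) ^ m)⁻¹) ^ (1 / q) *
        ENNReal.ofReal α ^ (m * (1 / s - 1 / q)) *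
        ∫⁻ x in ball z (t / 4), sliceAverage μ g t x ^ (1 / q) * v x ∂μ := by
  have hq : 0 < q := by linarith
  have hqs' : 0 ≤ 1 / q - 1 / s := sub_nonneg.2 (one_div_le_one_div_of_le hq hqs)
  have hB0 := h.ne_zero z (t / 4) (by positivity)
  have hB := h.ne_top z (t / 4) (by positivity)
  have hαt : α * t ≤ t / 2 := by nlinarith
  set A := (∫⁻ y in ball z (3 * t / 4), g y ∂μ) / μ (ball z (t / 4)) with hA
  have hHolder := setLIntegral_rpow_mul_le hB0 hB (measurable_sliceAverage μ hg (α * t)) hv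
    hq1 hqs hRH (c := K * (ENNReal.ofReal α ^ m)⁻¹) (A := A)
    (ae_restrict_of_forall_mem measurableSet_ball fun x hx => h.sliceAverage_le hm hg hα hα2 ht hx)
    (by
      rw [hA, ENNReal.div_mul_cancel hB0 hB]
      exact (setLIntegral_sliceAverage_le μ hg z _ _).trans
        (lintegral_mono_set (ball_subset_ball (by linarith))))
  have hconst : (K * (ENNReal.ofReal α ^ m)⁻¹) ^ (1 / q - 1 / s) =
      K ^ (1 / q - 1 / s) * ENNReal.ofReal α ^ (m * (1 / s - 1 / q)) := by
    rw [ENNReal.mul_rpow_of_nonneg _ _ hqs', ← ENNReal.rpow_neg, ← ENNReal.rpow_mul]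
    congr 2
    ring
  rw [hconst] at hHolder
  have hlower : A ^ (1 / q) * ∫⁻ x in ball z (t / 4), v x ∂μ ≤
      (K * (ENNReal.ofReal (1 / 8) ^ m)⁻¹) ^ (1 / q) *
        ∫⁻ x in ball z (t / 4), sliceAverage μ g t x ^ (1 / q) * v x ∂μ := by
    have hmeas : Measurable fun x => sliceAverage μ g t x ^ (1 / q) * v x :=
      ((measurable_sliceAverage μ hg t).pow_const _).mul hv
    rw [← lintegral_const_mul _ hv, ← lintegral_const_mul _ hmeas]
    refine setLIntegral_mono' measurableSet_ball fun x hx => ?_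
    rw [← mul_assoc, ← ENNReal.mul_rpow_of_nonneg _ _ (by positivity)]
    gcongr
    exact h.le_sliceAverage hm hg hK ht hx
  calc _ ≤ _ := hHolder
    _ = Cv * K ^ (1 / q - 1 / s) * ENNReal.ofReal α ^ (m * (1 / s - 1 / q)) *
        (A ^ (1 / q) * ∫⁻ x in ball z (t / 4), v x ∂μ) := by ring
    _ ≤ Cv * K ^ (1 / q - 1 / s) * ENNReal.ofReal α ^ (m * (1 / s - 1 / q)) * _ := by
        exact mul_le_mul_right hlower _
    _ = _ := by ring

/-- The change-of-angle estimate for a measure with `BallDecay` and a weight `v` satisfying a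
reverse Hölder inequality with respect to it. -/
theorem BallDecay.lintegral_sliceAverage_rpow_le {E : Type*} [NormedAddCommGroup E]
    [NormedSpace ℝ E] [FiniteDimensional ℝ E] [MeasureSpace E] [BorelSpace E]
    [(volume : Measure E).IsAddHaarMeasure] {μ : Measure E} [SFinite μ] {m : ℝ} {K : ℝ≥0∞}
    (h : BallDecay μ m K) (hm : 0 ≤ m) (hK : K ≠ ∞) {g v : E → ℝ≥0∞} (hg : Measurable g)
    (hv : Measurable v) {s q : ℝ} (hq1 : 1 ≤ q) (hqs : q ≤ s) {Cv : ℝ≥0∞}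
    (hRH : ∀ z ρ, 0 < ρ → (if s = 1 then essSup v (μ.restrict (ball z ρ))
      else ((∫⁻ x in ball z ρ, v x ^ (s / (s - 1)) ∂μ) / μ (ball z ρ)) ^ ((s - 1) / s))
      ≤ Cv * ((∫⁻ x in ball z ρ, v x ∂μ) / μ (ball z ρ)))
    {α t : ℝ} (hα : 0 < α) (hα1 : α ≤ 1) (ht : 0 < t) :
    ∫⁻ x, sliceAverage μ g (α * t) x ^ (1 / q) * v x ∂μ ≤
      (Cv * K ^ (1 / q - 1 / s) * (K * (ENNReal.ofReal (1 / 8) ^ m)⁻¹) ^ (1 / q) +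
        (K * (ENNReal.ofReal (1 / 2) ^ m)⁻¹) ^ (1 / q)) *
        ENNReal.ofReal α ^ (m * (1 / s - 1 / q)) *
        ∫⁻ x, sliceAverage μ g t x ^ (1 / q) * v x ∂μ := by
  have : ProperSpace E := FiniteDimensional.proper ℝ E
  have hq : 0 < q := by linarith
  have hmeas : ∀ ρ, Measurable fun x => sliceAverage μ g ρ x ^ (1 / q) * v x := fun ρ =>
    ((measurable_sliceAverage μ hg ρ).pow_const _).mul hv
  rcases le_total α (1 / 2) with hα2 | hα2
  · refine (lintegral_le_of_forall_setLIntegral_ball_le μ (hmeas _) (hmeas t)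
      (show 0 < t / 4 by positivity) fun z => h.setLIntegral_sliceAverage_rpow_le hm hK hg hv hq1
        hqs hα hα2 ht z (hRH z _ (by positivity))).trans ?_
    gcongr
    exact le_self_add
  · have hqs' : 0 ≤ 1 / q - 1 / s := sub_nonneg.2 (one_div_le_one_div_of_le hq hqs)
    have hone : 1 ≤ ENNReal.ofReal α ^ (m * (1 / s - 1 / q)) := by
      rw [show m * (1 / s - 1 / q) = -(m * (1 / q - 1 / s)) by ring, ENNReal.rpow_neg,
        ENNReal.one_le_inv]
      exact ENNReal.rpow_le_one (by simpa using hα1) (by positivity)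
    calc ∫⁻ x, sliceAverage μ g (α * t) x ^ (1 / q) * v x ∂μ
        ≤ ∫⁻ x, (K * (ENNReal.ofReal (1 / 2) ^ m)⁻¹) ^ (1 / q) *
            (sliceAverage μ g t x ^ (1 / q) * v x) ∂μ := by
          refine lintegral_mono fun x => ?_
          rw [← mul_assoc, ← ENNReal.mul_rpow_of_nonneg _ _ (by positivity)]
          gcongr
          exact h.sliceAverage_le_of_half_le hm hK g x hα2 hα1 ht
      _ = (K * (ENNReal.ofReal (1 / 2) ^ m)⁻¹) ^ (1 / q) * 1 *
            ∫⁻ x, sliceAverage μ g t x ^ (1 / q) * v x ∂μ := by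
          rw [lintegral_const_mul _ (hmeas t), mul_one]
      _ ≤ _ := by
          gcongr
          exact le_add_self

end metric

/-- The Hölder step behind `A_r`: on a subset `s` of a set `B` where `w` is nondegenerate, the
measure of `s` is controlled by the mass `∫ w` over `s` and the dual factor of `w` on `B`. -/
theorem measure_rpow_le_of_dual_ne_top {Y : Type*} [MeasurableSpace Y] {μ : Measure Y}
    {s B : Set Y} (hsB : s ⊆ B) (hB0 : μ B ≠ 0) (hB : μ B ≠ ∞) {w : Y → ℝ≥0∞}
    (hw : Measurable w) (hwB : ∫⁻ x in B, w x ∂μ ≠ ∞) {r : ℝ} (hr : 1 ≤ r) {D : ℝ≥0∞}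
    (hD : D = if r = 1 then essSup (fun x => (w x)⁻¹) (μ.restrict B)
      else ((∫⁻ x in B, w x ^ (-(1 / (r - 1))) ∂μ) / μ B) ^ (r - 1)) (hDtop : D ≠ ∞) :
    μ s ^ r ≤ (∫⁻ x in s, w x ∂μ) * (D * μ B ^ (r - 1)) := by
  have hwtop : ∀ᵐ x ∂μ.restrict s, w x ≠ ∞ := ae_restrict_of_ae_restrict_of_subset hsB
    ((ae_lt_top hw hwB).mono fun x hx => hx.ne)
  split_ifs at hD with h1
  · subst h1
    have hinv : ∀ᵐ x ∂μ.restrict s, (w x)⁻¹ ≤ D := by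
      refine ae_restrict_of_ae_restrict_of_subset hsB ?_
      rw [hD]
      exact ENNReal.ae_le_essSup _
    rw [sub_self, ENNReal.rpow_zero, mul_one, ENNReal.rpow_one, ← lintegral_mul_const _ hw,
      ← setLIntegral_one]
    refine lintegral_mono_ae ?_
    filter_upwards [hwtop, hinv] with x hx hxD
    have hx0 : w x ≠ 0 := ENNReal.inv_ne_top.1 (ne_top_of_le_ne_top hDtop hxD)
    rw [← ENNReal.mul_inv_cancel hx0 hx]
    gcongr
  · have hr1 : 1 < r := lt_of_le_of_ne hr (Ne.symm h1)
    have hr0 : 0 < r - 1 := by linarith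
    have hrpos : 0 < r := by linarith
    have hconj : r.HolderConjugate (r / (r - 1)) := Real.HolderConjugate.conjExponent hr1
    have hmeas : Measurable fun x => w x ^ (-(1 / (r - 1))) := hw.pow_const _
    set I := ∫⁻ x in B, w x ^ (-(1 / (r - 1))) ∂μ with hI
    have hDI : D * μ B ^ (r - 1) = I ^ (r - 1) := by
      rw [hD, ← ENNReal.mul_rpow_of_nonneg _ _ hr0.le, ENNReal.div_mul_cancel hB0 hB]
    have hItop : I ≠ ∞ := by
      intro hI'
      refine ENNReal.mul_ne_top hDtop (ENNReal.rpow_ne_top_of_nonneg hr0.le hB) ?_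
      rw [hDI, hI', ENNReal.top_rpow_of_pos hr0]
    have hw0 : ∀ᵐ x ∂μ.restrict s, w x ≠ 0 := by
      refine ae_restrict_of_ae_restrict_of_subset hsB ?_
      filter_upwards [ae_lt_top hmeas hItop] with x hx hx0
      rw [hx0, ENNReal.zero_rpow_of_neg (by rw [neg_lt_zero]; positivity)] at hx
      exact lt_irrefl _ hx
    have hHolder : μ s ≤ (∫⁻ x in s, w x ∂μ) ^ (1 / r) * I ^ ((r - 1) / r) := by
      calc μ s = ∫⁻ x in s, w x ^ (1 / r) * w x ^ (-(1 / r)) ∂μ := by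
            rw [← setLIntegral_one]
            refine lintegral_congr_ae ?_
            filter_upwards [hwtop, hw0] with x hx hx0
            rw [← ENNReal.rpow_add _ _ hx0 hx, add_neg_cancel, ENNReal.rpow_zero]
        _ ≤ (∫⁻ x in s, (w x ^ (1 / r)) ^ r ∂μ) ^ (1 / r) *
              (∫⁻ x in s, (w x ^ (-(1 / r))) ^ (r / (r - 1)) ∂μ) ^ (1 / (r / (r - 1))) :=
            ENNReal.lintegral_mul_le_Lp_mul_Lq _ hconj (hw.pow_const _).aemeasurable
              (hw.pow_const _).aemeasurable
        _ = (∫⁻ x in s, w x ∂μ) ^ (1 / r) *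
              (∫⁻ x in s, w x ^ (-(1 / (r - 1))) ∂μ) ^ ((r - 1) / r) := by
            simp only [← ENNReal.rpow_mul]
            rw [one_div_mul_cancel hrpos.ne', one_div_div,
              show -(1 / r) * (r / (r - 1)) = -(1 / (r - 1)) by field_simp]
            simp only [ENNReal.rpow_one]
        _ ≤ _ := by
            gcongr
            exact lintegral_mono_set hsB
    calc μ s ^ r ≤ ((∫⁻ x in s, w x ∂μ) ^ (1 / r) * I ^ ((r - 1) / r)) ^ r := by gcongr
      _ = _ := by
        rw [ENNReal.mul_rpow_of_nonneg _ _ hrpos.le, ← ENNReal.rpow_mul, ← ENNReal.rpow_mul,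
          one_div_mul_cancel hrpos.ne', div_mul_cancel₀ _ hrpos.ne', ENNReal.rpow_one, hDI]

theorem apBound.ballDecay {n : ℕ} {w : EuclideanSpace ℝ (Fin n) → ℝ≥0∞} {r : ℝ} (hr : 1 ≤ r)
    {Cw : ℝ≥0∞} (hCw : Cw ≠ ∞) (hw : Measurable w)
    (hpos : ∀ (c : EuclideanSpace ℝ (Fin n)) (ρ : ℝ), 0 < ρ →
      0 < (∫⁻ x in ball c ρ, w x) ∧ (∫⁻ x in ball c ρ, w x) ≠ ∞)
    (hA : apBound n w r Cw) : BallDecay (volume.withDensity w) (n * r) Cw := by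
  have hμ : ∀ c ρ, volume.withDensity w (ball c ρ) = ∫⁻ x in ball c ρ, w x := fun c ρ =>
    withDensity_apply _ measurableSet_ball
  refine ⟨fun c ρ hρ => ?_, fun c ρ hρ => ?_, fun c ρ R hρ hρR => ?_⟩
  · rw [hμ]; exact (hpos c ρ hρ).1.ne'
  · rw [hμ]; exact (hpos c ρ hρ).2
  rw [hμ, hμ]
  have hR : 0 < R := hρ.trans_le hρR
  have hB0 : volume (ball c R) ≠ 0 := (measure_ball_pos _ _ hR).ne'
  have hB : volume (ball c R) ≠ ∞ := measure_ball_lt_top.ne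
  set V := volume (ball c R)
  set W := ∫⁻ x in ball c R, w x
  set D := if r = 1 then essSup (fun x => (w x)⁻¹) (volume.restrict (ball c R))
      else ((∫⁻ x in ball c R, w x ^ (-(1 / (r - 1)))) / V) ^ (r - 1) with hD
  have hWD : W / V * D ≤ Cw := by
    have := hA c R hR
    rw [hD]
    split_ifs at this ⊢ <;> exact this
  have hDtop : D ≠ ∞ := by
    intro h
    rw [h, ENNReal.mul_top (ENNReal.div_ne_zero.2 ⟨(hpos c R hR).1.ne', hB⟩)] at hWD
    exact hCw (top_le_iff.1 hWD)
  have hdual := measure_rpow_le_of_dual_ne_top (ball_subset_ball hρR) hB0 hB hw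
    (hpos c R hR).2 hr hD hDtop
  have hscale : volume (ball c ρ) = ENNReal.ofReal (ρ / R) ^ n * V := by
    have := Measure.addHaar_ball_mul_of_pos (volume : Measure (EuclideanSpace ℝ (Fin n))) c
      (div_pos hρ hR) R
    rwa [div_mul_cancel₀ _ hR.ne', finrank_euclideanSpace_fin, ENNReal.ofReal_pow (by positivity),
      ← Measure.addHaar_ball_center volume c R] at this
  have hVr0 : V ^ r ≠ 0 := (ENNReal.rpow_pos hB0.bot_lt hB).ne'
  have hVr : V ^ r ≠ ∞ := ENNReal.rpow_ne_top_of_nonneg (by linarith) hB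
  rw [hscale, ENNReal.mul_rpow_of_nonneg _ _ (by linarith), ← ENNReal.rpow_natCast,
    ← ENNReal.rpow_mul] at hdual
  refine (ENNReal.mul_le_mul_iff_left hVr0 hVr).1 ?_
  calc ENNReal.ofReal (ρ / R) ^ (n * r) * W * V ^ r
      = ENNReal.ofReal (ρ / R) ^ (n * r) * V ^ r * W := by ring
    _ ≤ (∫⁻ x in ball c ρ, w x) * (D * V ^ (r - 1)) * W := by gcongr
    _ = (W / V * D) * (∫⁻ x in ball c ρ, w x) * (V ^ (1 : ℝ) * V ^ (r - 1)) := by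
        nth_rewrite 1 [← ENNReal.div_mul_cancel hB0 hB (b := W)]
        rw [ENNReal.rpow_one]
        ring
    _ ≤ Cw * (∫⁻ x in ball c ρ, w x) * (V ^ (1 : ℝ) * V ^ (r - 1)) := by gcongr
    _ = _ := by rw [← ENNReal.rpow_add _ _ hB0 hB, add_sub_cancel]

/-- A lower integral of an arbitrary function over the slices of a cone is attained by a
measurable minorant. -/
theorem exists_measurable_le_setLIntegral_ball_eq {X : Type*} [PseudoMetricSpace X]
    [SecondCountableTopology X] [MeasurableSpace X] [BorelSpace X] {ν : Measure X} [SFinite ν]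
    {w : X → ℝ≥0∞} (hw : Measurable w) (hwtop : ∀ᵐ x ∂ν, w x ≠ ∞) {W : X → ℝ≥0∞}
    (hW : Measurable W) (hW0 : ∀ x, W x ≠ 0) (hWtop : ∀ x, W x ≠ ∞) (f : X → ℝ≥0∞) :
    ∃ g, Measurable g ∧ g ≤ f ∧
      ∀ s, ∫⁻ y in s, f y * w y / W y ∂ν = ∫⁻ y in s, g y * w y / W y ∂ν := by
  obtain ⟨k, hk, hkf, hint⟩ := exists_measurable_le_forall_setLIntegral_eq ν
    fun y => f y * w y / W y
  refine ⟨fun y => k y * W y / w y, (hk.mul hW).div hw, fun y => ?_, fun s => ?_⟩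
  · calc k y * W y / w y ≤ f y * w y / W y * W y / w y := by gcongr; exact hkf y
      _ = f y * w y / w y := by rw [ENNReal.div_mul_cancel (hW0 y) (hWtop y)]
      _ ≤ f y := ENNReal.div_le_of_le_mul le_rfl
  · rw [hint s]
    refine lintegral_congr_ae (ae_restrict_of_ae ?_)
    filter_upwards [hwtop] with y hy
    rcases eq_or_ne (w y) 0 with h0 | h0
    · have := hkf y
      simp only [h0, mul_zero, ENNReal.zero_div, nonpos_iff_eq_zero] at this
      simp [h0, this]
    · rw [ENNReal.div_mul_cancel h0 hy, ENNReal.mul_div_cancel_right (hW0 y) (hWtop y)]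

theorem ae_ne_top_of_setLIntegral_ball_ne_top {X : Type*} [PseudoMetricSpace X]
    [MeasurableSpace X] {ν : Measure X} {w : X → ℝ≥0∞} (hw : Measurable w) (c : X)
    (h : ∀ ρ, 0 < ρ → ∫⁻ x in ball c ρ, w x ∂ν ≠ ∞) : ∀ᵐ x ∂ν, w x ≠ ∞ := by
  rw [← Measure.restrict_univ (μ := ν), ← iUnion_ball_nat_succ c, ae_restrict_iUnion_iff]
  exact fun k => (ae_lt_top hw (h _ (by positivity))).mono fun x hx => hx.ne

/-- for `w ∈ A_r`, `v ∈ RH_{s'}(w)`, `1 ≤ q ≤ s`, `0 < α ≤ 1` and `t > 0`,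
`∫ (∫_{B(x,αt)} |h| dw/w(B(y,αt)))^{1/q} v dw ≲ α^{nr(1/s - 1/q)}
  ∫ (∫_{B(x,t)} |h| dw/w(B(y,t)))^{1/q} v dw`, with the constant independent of `α` and `t`. -/
theorem shrinking_ball_average_estimate
    (n : ℕ) (r s q : ℝ) (hr : 1 ≤ r) (hs : 1 ≤ s) (hq1 : 1 ≤ q) (hqs : q ≤ s)
    (Cw Cv : ℝ≥0) :
    ∃ C : ℝ≥0, ∀ (w v : EuclideanSpace ℝ (Fin n) → ℝ≥0∞)
      (h : EuclideanSpace ℝ (Fin n) → ℂ) (α t : ℝ),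
      Measurable w → Measurable v →
      (∀ (c : EuclideanSpace ℝ (Fin n)) (ρ : ℝ), 0 < ρ →
        0 < (∫⁻ x in ball c ρ, w x) ∧ (∫⁻ x in ball c ρ, w x) ≠ ∞) →
      apBound n w r Cw → rhConjBoundW n w v s Cv →
      0 < α → α ≤ 1 → 0 < t →
      (∫⁻ x, (∫⁻ y in ball x (α * t),
          (‖h y‖₊ : ℝ≥0∞) * w y / (∫⁻ z in ball y (α * t), w z)) ^ (1/q) * (v x * w x)) ≤
        C * ENNReal.ofReal α ^ ((n : ℝ) * r * (1/s - 1/q)) *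
          (∫⁻ x, (∫⁻ y in ball x t,
            (‖h y‖₊ : ℝ≥0∞) * w y / (∫⁻ z in ball y t, w z)) ^ (1/q) * (v x * w x)) := by
  have hm : 0 ≤ (n : ℝ) * r := mul_nonneg n.cast_nonneg (by linarith)
  have hq : 0 < q := by linarith
  have hq' : 0 ≤ 1 / q := by positivity
  have hqs' : 0 ≤ 1 / q - 1 / s := sub_nonneg.2 (one_div_le_one_div_of_le hq hqs)
  have hfin : ∀ a : ℝ, 0 < a → (Cw * (ENNReal.ofReal a ^ ((n : ℝ) * r))⁻¹ : ℝ≥0∞) ^ (1 / q) ≠ ∞ :=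
    fun a ha => ENNReal.rpow_ne_top_of_nonneg hq' (ENNReal.mul_ne_top ENNReal.coe_ne_top
      (ENNReal.inv_ne_top.2 (ENNReal.rpow_pos (by simpa) ENNReal.ofReal_ne_top).ne'))
  obtain ⟨C, hC⟩ : ∃ C : ℝ≥0, (C : ℝ≥0∞) = _ := ⟨_, ENNReal.coe_toNNReal <|
    ENNReal.add_ne_top.2 ⟨ENNReal.mul_ne_top (ENNReal.mul_ne_top (ENNReal.coe_ne_top (r := Cv))
      (ENNReal.rpow_ne_top_of_nonneg hqs' (ENNReal.coe_ne_top (r := Cw)))) (hfin (1 / 8) (by norm_num)),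
      hfin (1 / 2) (by norm_num)⟩⟩
  refine ⟨C, fun w v h α t hw hv hpos hA hRH hα hα1 ht => ?_⟩
  rw [hC]
  set μ := (volume : Measure (EuclideanSpace ℝ (Fin n))).withDensity w with hμdef
  have hdecay : BallDecay μ (n * r) Cw := hA.ballDecay hr ENNReal.coe_ne_top hw hpos
  have hαt : 0 < α * t := by positivity
  have hμ : ∀ c ρ, ∫⁻ x in ball c ρ, w x = μ (ball c ρ) := fun c ρ =>
    (withDensity_apply _ measurableSet_ball).symm
  have hset : ∀ {f : EuclideanSpace ℝ (Fin n) → ℝ≥0∞}, Measurable f → ∀ c ρ,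
      ∫⁻ x in ball c ρ, f x ∂μ = ∫⁻ x in ball c ρ, f x * w x := fun {f} hf c ρ => by
    rw [hμdef, setLIntegral_withDensity_eq_setLIntegral_mul _ hw hf measurableSet_ball]
    simp only [Pi.mul_apply, mul_comm]
  have hslice : ∀ {g : EuclideanSpace ℝ (Fin n) → ℝ≥0∞}, Measurable g → ∀ ρ x,
      ∫⁻ y in ball x ρ, g y * w y / μ (ball y ρ) = sliceAverage μ g ρ x := fun {g} hg ρ x => by
    rw [sliceAverage, hset (f := fun y => g y / μ (ball y ρ))
      (hg.div (measurable_measure_ball μ ρ))]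
    simp only [ENNReal.mul_div_right_comm]
  have hglobal : ∀ {g : EuclideanSpace ℝ (Fin n) → ℝ≥0∞}, Measurable g → ∀ ρ,
      ∫⁻ x, sliceAverage μ g ρ x ^ (1 / q) * v x ∂μ =
        ∫⁻ x, sliceAverage μ g ρ x ^ (1 / q) * (v x * w x) := fun {g} hg ρ => by
    have hmeas : Measurable fun x => sliceAverage μ g ρ x ^ (1 / q) * v x :=
      ((measurable_sliceAverage μ hg ρ).pow_const _).mul hv
    rw [hμdef, lintegral_withDensity_eq_lintegral_mul _ hw hmeas]
    refine lintegral_congr fun x => ?_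
    simp only [Pi.mul_apply]
    ring
  simp only [hμ]
  obtain ⟨g, hg, hgh, hint⟩ := exists_measurable_le_setLIntegral_ball_eq hw
    (ae_ne_top_of_setLIntegral_ball_ne_top hw 0 fun ρ hρ => (hpos 0 ρ hρ).2)
    (measurable_measure_ball μ (α * t)) (fun x => hdecay.ne_zero x _ hαt)
    (fun x => hdecay.ne_top x _ hαt) (fun y => (‖h y‖₊ : ℝ≥0∞))
  simp only [hint, hslice hg]
  rw [← hglobal hg]
  refine (hdecay.lintegral_sliceAverage_rpow_le hm ENNReal.coe_ne_top hg hv hq1 hqs (Cv := Cv)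
    (fun z ρ hρ => ?_) hα hα1 ht).trans ?_
  · have := hRH z ρ hρ
    rwa [hset hv, hset (hv.pow_const _), ← hμ]
  · rw [hglobal hg]
    gcongr with x
    rw [← hslice hg]
    refine lintegral_mono fun y => ?_
    gcongr
    exact hgh y
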